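/- Let m, n be positive integers, let M_m be an m×m real magic square with magic sum μ_m and M_n an n×n real magic square with magic sum μ_n. Set A = E_m ⊗ M_n, B = M_m ⊗ E_n, and M^A = A + n² • B. Then M^A is a magic square on Fin m × Fin n with magic sum m·μ_n + n³·μ_m (all row sums, all column sums, trace(M^A), and trace((R_m ⊗ R_n) * M^A) equal m·μ_n + n³·μ_m). Moreover, if μ_m = m(m² − 1)/2 and μ_n = n(n² − 1)/2, then this magic sum equals (m·n)((m·n)² − 1)/2. -/

import Mathlib

open Matrix Kronecker BigOperators

/-- The `n × n` all-ones matrix. -/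
noncomputable def E (n : ℕ) : Matrix (Fin n) (Fin n) ℝ := Matrix.of fun _ _ => 1

/-- The `n × n` exchange matrix. -/
noncomputable def R (n : ℕ) : Matrix (Fin n) (Fin n) ℝ :=
  Matrix.of fun i j => if (i : ℕ) + (j : ℕ) = n - 1 then 1 else 0

theorem sum_E_row (n : ℕ) (i : Fin n) : ∑ j, E n i j = n := by
  simp [E]

theorem sum_E_col (n : ℕ) (j : Fin n) : ∑ i, E n i j = n := by
  simp [E]

theorem trace_E (n : ℕ) : Matrix.trace (E n) = n := by
  simp [E, Matrix.trace]

theorem exchange_apply (n : ℕ) (i j : Fin n) : R n i j = if j = Fin.rev i then 1 else 0 := by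
  have h : (i : ℕ) + j = n - 1 ↔ j = Fin.rev i := by
    rw [Fin.ext_iff, Fin.val_rev]
    lia
  simp [R, h]

theorem trace_R_mul_E (n : ℕ) : Matrix.trace (R n * E n) = n := by
  simp [Matrix.trace, Matrix.mul_apply, exchange_apply, E]

/-- The Euler composition `M^A = (E_m ⊗ M_n) + n² • (M_m ⊗ E_n)` of two magic squares is
a magic square with magic sum `m·μ_n + n³·μ_m`, which equals `(mn)((mn)² - 1)/2` when
`μ_m`, `μ_n` are the natural magic sums. -/
theorem euler_composition_magic (m n : ℕ) (hm : 0 < m) (hn : 0 < n)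
    (Mm : Matrix (Fin m) (Fin m) ℝ) (Mn : Matrix (Fin n) (Fin n) ℝ) (μm μn : ℝ)
    (hmrow : ∀ i, ∑ j, Mm i j = μm)
    (hmcol : ∀ j, ∑ i, Mm i j = μm)
    (hmtr : Matrix.trace Mm = μm)
    (hmanti : Matrix.trace (R m * Mm) = μm)
    (hnrow : ∀ i, ∑ j, Mn i j = μn)
    (hncol : ∀ j, ∑ i, Mn i j = μn)
    (hntr : Matrix.trace Mn = μn)
    (hnanti : Matrix.trace (R n * Mn) = μn) :
    (∀ p, ∑ q, ((E m ⊗ₖ Mn) + ((n : ℝ)^2) • (Mm ⊗ₖ E n)) p q = (m : ℝ) * μn + (n : ℝ)^3 * μm) ∧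
    (∀ q, ∑ p, ((E m ⊗ₖ Mn) + ((n : ℝ)^2) • (Mm ⊗ₖ E n)) p q = (m : ℝ) * μn + (n : ℝ)^3 * μm) ∧
    Matrix.trace ((E m ⊗ₖ Mn) + ((n : ℝ)^2) • (Mm ⊗ₖ E n)) = (m : ℝ) * μn + (n : ℝ)^3 * μm ∧
    Matrix.trace ((R m ⊗ₖ R n) * ((E m ⊗ₖ Mn) + ((n : ℝ)^2) • (Mm ⊗ₖ E n)))
      = (m : ℝ) * μn + (n : ℝ)^3 * μm ∧
    (μm = (m : ℝ) * ((m : ℝ)^2 - 1) / 2 → μn = (n : ℝ) * ((n : ℝ)^2 - 1) / 2 →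
      (m : ℝ) * μn + (n : ℝ)^3 * μm
        = ((m : ℝ) * (n : ℝ)) * (((m : ℝ) * (n : ℝ))^2 - 1) / 2) := by
  refine ⟨?_, ?_, ?_, ?_, ?_⟩
  · rintro ⟨i, k⟩
    simp only [Matrix.add_apply, Matrix.smul_apply, kroneckerMap_apply, smul_eq_mul,
      Fintype.sum_prod_type, Finset.sum_add_distrib, ← Finset.mul_sum, ← Finset.sum_mul,
      hmrow, hnrow, sum_E_row]
    ring
  · rintro ⟨j, l⟩
    simp only [Matrix.add_apply, Matrix.smul_apply, kroneckerMap_apply, smul_eq_mul,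
      Fintype.sum_prod_type, Finset.sum_add_distrib, ← Finset.mul_sum, ← Finset.sum_mul,
      hmcol, hncol, sum_E_col]
    ring
  · rw [trace_add, trace_smul, trace_kronecker, trace_kronecker, hmtr, hntr, trace_E, trace_E,
      smul_eq_mul]
    ring
  · rw [Matrix.mul_add, Matrix.mul_smul, ← mul_kronecker_mul, ← mul_kronecker_mul, trace_add,
      trace_smul, trace_kronecker, trace_kronecker, hmanti, hnanti, trace_R_mul_E, trace_R_mul_E,
      smul_eq_mul]
    ring
  · rintro rfl rfl
    ring
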